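/- Let p be a prime, q a power of p, and μ : ℚ_p^* → 𝔽_q^* a group homomorphism. Suppose f : GL₂(ℚ_p) → 𝔽_q is a locally constant function with f(bg) = μ(b₁₁)·μ(b₂₂)·f(g) for every upper triangular matrix b ∈ B(ℚ_p) and every g ∈ GL₂(ℚ_p), and suppose that for every s ∈ SL₂(ℚ_p) there exists a constant c_s ∈ 𝔽_q such that f(gs) = f(g) + c_s·μ(det g) for all g ∈ GL₂(ℚ_p). Then there exists c ∈ 𝔽_q with f(g) = c·μ(det g) for all g ∈ GL₂(ℚ_p). (Equivalently: the SL₂(ℚ_p)-invariants of the twist of the Steinberg representation St ⊗ μ = Ind_{B(ℚ_p)}^{GL₂(ℚ_p)}(μ, μ) / 𝔽_q·(μ∘det) vanish.) -/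

import Mathlib

open Matrix

/-- A function whose right translates by determinant-one matrices differ from it by multiples of
`χ ∘ det` is invariant under right translation by every commutator `n = t * m * t⁻¹ * m⁻¹` of
determinant-one matrices. -/
theorem right_translate_eq_of_mul_eq {K F : Type*} [Field K] [Field F] {χ : Kˣ →* Fˣ}
    {f : GL (Fin 2) K → F}
    (hSL : ∀ s : GL (Fin 2) K, (s : Matrix (Fin 2) (Fin 2) K).det = 1 →
      ∃ c : F, ∀ g : GL (Fin 2) K,
        f (g * s) = f g + c * (χ (Matrix.GeneralLinearGroup.det g) : F))
    {t m n : GL (Fin 2) K} (ht : (t : Matrix (Fin 2) (Fin 2) K).det = 1)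
    (hm : (m : Matrix (Fin 2) (Fin 2) K).det = 1) (hn : (n : Matrix (Fin 2) (Fin 2) K).det = 1)
    (h : t * m = n * m * t) (g : GL (Fin 2) K) : f (g * n) = f g := by
  obtain ⟨c, hc⟩ := hSL t ht
  obtain ⟨d, hd⟩ := hSL m hm
  have det_t : Matrix.GeneralLinearGroup.det t = 1 := Units.ext ht
  have det_m : Matrix.GeneralLinearGroup.det m = 1 := Units.ext hm
  have det_n : Matrix.GeneralLinearGroup.det n = 1 := Units.ext hn
  have key : f (g * t * m) = f (g * n * m * t) := by
    rw [mul_assoc g, h]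
    simp only [mul_assoc]
  rw [hd, hc, hc, hd] at key
  simp only [map_mul, det_t, det_m, det_n, mul_one] at key
  linear_combination -key

/-- Over a field of characteristic zero, a function on `GL₂` that transforms by `(χ, χ)` under the
Borel subgroup and whose class modulo `χ ∘ det` is `SL₂`-invariant is a multiple of `χ ∘ det`. -/
theorem eq_const_mul_det_of_SL2_invariant {K F : Type*} [Field K] [CharZero K] [Field F]
    (χ : Kˣ →* Fˣ) (f : GL (Fin 2) K → F)
    (hB : ∀ b g : GL (Fin 2) K,
      (b : Matrix (Fin 2) (Fin 2) K) 1 0 = 0 →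
      ∀ u v : Kˣ,
        (u : K) = (b : Matrix (Fin 2) (Fin 2) K) 0 0 →
        (v : K) = (b : Matrix (Fin 2) (Fin 2) K) 1 1 →
        f (b * g) = (χ u : F) * (χ v : F) * f g)
    (hSL : ∀ s : GL (Fin 2) K, (s : Matrix (Fin 2) (Fin 2) K).det = 1 →
      ∃ c : F, ∀ g : GL (Fin 2) K,
        f (g * s) = f g + c * (χ (Matrix.GeneralLinearGroup.det g) : F)) :
    ∃ c : F, ∀ g : GL (Fin 2) K,
      f g = c * (χ (Matrix.GeneralLinearGroup.det g) : F) := by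
  have inv (t m n : Matrix (Fin 2) (Fin 2) K) (ht : t.det = 1) (hm : m.det = 1)
      (hn : n.det = 1) (h : t * m = n * m * t) (g : GL (Fin 2) K) :
      f (g * .mkOfDetNeZero n (hn.trans_ne one_ne_zero)) = f g := by
    have val_mk (a : Matrix (Fin 2) (Fin 2) K) (ha : a.det ≠ 0) :
        (Matrix.GeneralLinearGroup.mkOfDetNeZero a ha).val = a := rfl
    refine right_translate_eq_of_mul_eq hSL (t := .mkOfDetNeZero t (ht.trans_ne one_ne_zero))
      (m := .mkOfDetNeZero m (hm.trans_ne one_ne_zero)) ?_ ?_ ?_ (Units.ext ?_) g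
    all_goals simpa only [Units.val_mul, val_mk]
  have det_upper (x : K) : (!![1, x; 0, 1]).det = 1 := by simp [Matrix.det_fin_two]
  have det_lower (x : K) : (!![1, 0; x, 1]).det = 1 := by simp [Matrix.det_fin_two]
  have upper (x : K) := inv !![2, 0; 0, 2⁻¹] !![1, x / 3; 0, 1] !![1, x; 0, 1]
    (by simp [Matrix.det_fin_two]) (det_upper _) (det_upper _)
    (by
      ext i j
      fin_cases i <;> fin_cases j <;> simp [Matrix.mul_apply, Fin.sum_univ_two]
      ring)
  have lower (x : K) := inv !![2⁻¹, 0; 0, 2] !![1, 0; x / 3, 1] !![1, 0; x, 1]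
    (by simp [Matrix.det_fin_two]) (det_lower _) (det_lower _)
    (by
      ext i j
      fin_cases i <;> fin_cases j <;> simp [Matrix.mul_apply, Fin.sum_univ_two]
      ring)
  have triangular (b : GL (Fin 2) K) (hb : b 1 0 = 0) :
      f b = f 1 * (χ (Matrix.GeneralLinearGroup.det b) : F) := by
    have hdet : (Matrix.GeneralLinearGroup.det b : K) = b 0 0 * b 1 1 := by
      simp [Matrix.det_fin_two, hb]
    have hne : b 0 0 * b 1 1 ≠ 0 := hdet ▸ Units.ne_zero _
    have h := hB b 1 hb (.mk0 _ (left_ne_zero_of_mul hne)) (.mk0 _ (right_ne_zero_of_mul hne))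
      rfl rfl
    rw [mul_one, ← Units.val_mul, ← map_mul] at h
    rw [h, mul_comm]
    congr 3
    exact Units.ext hdet.symm
  have of_ne_zero (g : GL (Fin 2) K) (hg : g 1 1 ≠ 0) :
      f g = f 1 * (χ (Matrix.GeneralLinearGroup.det g) : F) := by
    rw [← lower (-(g 1 0 / g 1 1)) g, triangular]
    · congr 3
      ext
      simp
    · simp [Matrix.mul_apply, Fin.sum_univ_two]
      field_simp
      ring
  refine ⟨f 1, fun g => ?_⟩
  by_cases hg : g 1 1 = 0
  · have hdet : (Matrix.GeneralLinearGroup.det g : K) ≠ 0 := Units.ne_zero _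
    rw [← upper 1 g, of_ne_zero]
    · congr 3
      ext
      simp
    · intro h
      simp [Matrix.mul_apply, Fin.sum_univ_two, hg] at h
      simp [Matrix.det_fin_two, hg, h] at hdet
  · exact of_ne_zero g hg

/-- The `SL₂(ℚ_p)`-invariants of the twist `St ⊗ μ` of the Steinberg representation
vanish: if a locally constant `f : GL₂(ℚ_p) → 𝔽_q` transforms by `(μ, μ)` under left
translation by upper triangular matrices, and if for every `s ∈ SL₂(ℚ_p)` there is
`c_s ∈ 𝔽_q` with `f(gs) = f(g) + c_s·μ(det g)` for all `g` (i.e. the image of `f` in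
`St ⊗ μ` is `SL₂(ℚ_p)`-invariant), then `f` is a multiple of `g ↦ μ(det g)` (i.e. its
image in `St ⊗ μ` is zero). -/
theorem steinberg_twist_SL2_invariants_eq_zero
    (p : ℕ) [Fact p.Prime] (k : ℕ) (hk : 0 < k)
    (F : Type*) [Field F] [Fintype F] (hF : Fintype.card F = p ^ k)
    (μ : ℚ_[p]ˣ →* Fˣ)
    (f : GL (Fin 2) ℚ_[p] → F) (hf : IsLocallyConstant f)
    (hB : ∀ b g : GL (Fin 2) ℚ_[p],
      (b : Matrix (Fin 2) (Fin 2) ℚ_[p]) 1 0 = 0 →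
      ∀ u v : ℚ_[p]ˣ,
        (u : ℚ_[p]) = (b : Matrix (Fin 2) (Fin 2) ℚ_[p]) 0 0 →
        (v : ℚ_[p]) = (b : Matrix (Fin 2) (Fin 2) ℚ_[p]) 1 1 →
        f (b * g) = (μ u : F) * (μ v : F) * f g)
    (hSL : ∀ s : GL (Fin 2) ℚ_[p], (s : Matrix (Fin 2) (Fin 2) ℚ_[p]).det = 1 →
      ∃ c : F, ∀ g : GL (Fin 2) ℚ_[p],
        f (g * s) = f g + c * (μ (Matrix.GeneralLinearGroup.det g) : F)) :
    ∃ c : F, ∀ g : GL (Fin 2) ℚ_[p],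
      f g = c * (μ (Matrix.GeneralLinearGroup.det g) : F) :=
  eq_const_mul_det_of_SL2_invariant μ f hB hSL
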